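/- Let p be a prime, n ≥ 1, let G be an abelian group with p^n·G = 0, and let A be an abelian group with no p^n-torsion (p^n·a = 0 implies a = 0). Then the p^n-map construction induces a bijection between the set of equivalence classes of extensions of G by A and the group Hom(G, A/p^nA). Concretely: (i) for every group homomorphism f : G → A/p^nA there exists a short exact sequence 0 → A → E → G → 0 whose p^n-map equals f (one may take E = {(a, g) ∈ A × G : a mod p^nA = f(g)} with A included via a ↦ (p^n·a, 0)); and (ii) any two extensions of G by A whose p^n-maps coincide are equivalent. -/

import Mathlib

/-- The multiplication-by-`m` homomorphism of an abelian group. -/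
def nsmulHom (m : ℕ) (A : Type*) [AddCommGroup A] : A →+ A :=
  DistribMulAction.toAddMonoidHom A m

/-- `ψ : G →+ A/mA` is *the* `m`-map (snake map) of the extension `0 → A →ι E →π G → 0`
(with `m • G = 0`) if for every `g ∈ G`, every lift `e ∈ E` of `g` and every `a ∈ A` with
`ι a = m • e`, one has `ψ g = a mod mA`. -/
def IsSnakeMap {A E G : Type*} [AddCommGroup A] [AddCommGroup E] [AddCommGroup G]
    (m : ℕ) (ι : A →+ E) (π : E →+ G)
    (ψ : G →+ A ⧸ (nsmulHom m A).range) : Prop :=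
  ∀ (g : G) (e : E), π e = g → ∀ a : A, ι a = m • e → ψ g = QuotientAddGroup.mk a

/-- For `f : G →+ A/mA`, the subgroup `{(a, g) ∈ A × G : a mod mA = f g}` of `A × G`,
which is an extension of `G` by `A` (via `a ↦ (m • a, 0)`) whose `m`-map is `f`. -/
def standardExtension (m : ℕ) {A G : Type*} [AddCommGroup A] [AddCommGroup G]
    (f : G →+ A ⧸ (nsmulHom m A).range) : AddSubgroup (A × G) where
  carrier := {x | (QuotientAddGroup.mk x.1 : A ⧸ (nsmulHom m A).range) = f x.2}
  zero_mem' := by simp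
  add_mem' := by
    intro a b ha hb
    simp only [Set.mem_setOf_eq, Prod.fst_add, Prod.snd_add, map_add,
      QuotientAddGroup.mk_add] at *
    rw [ha, hb]
  neg_mem' := by
    intro a ha
    simp only [Set.mem_setOf_eq, Prod.fst_neg, Prod.snd_neg, map_neg,
      QuotientAddGroup.mk_neg] at *
    rw [ha]

theorem snake_aux {A E G : Type*} [AddCommGroup A] [AddCommGroup E] [AddCommGroup G]
    (m : ℕ) (hG : ∀ g : G, m • g = 0) (hA : ∀ a : A, m • a = 0 → a = 0)
    (ι : A →+ E) (π : E →+ G) (hι : Function.Injective ι) (hπ : Function.Surjective π)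
    (hex : ι.range = π.ker) (ψ : G →+ A ⧸ (nsmulHom m A).range) (hψ : IsSnakeMap m ι π ψ) :
    ∃ Φ : E ≃+ standardExtension m ψ,
      (∀ a, (Φ (ι a) : A × G) = (m • a, 0)) ∧ ∀ e, (Φ e : A × G).2 = π e := by
  have h0 : ∀ a, π (ι a) = 0 := fun a => by
    have : ι a ∈ π.ker := hex ▸ ⟨a, rfl⟩
    exact this
  have h1 : ∀ e, ∃ a, ι a = m • e := fun e => by
    have : m • e ∈ ι.range := by
      rw [hex, AddMonoidHom.mem_ker, map_nsmul, hG]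
    exact this
  choose r hr using h1
  let F : E →+ standardExtension m ψ :=
    { toFun := fun e => ⟨(r e, π e), (hψ (π e) e rfl (r e) (hr e)).symm⟩
      map_zero' := by
        apply Subtype.ext
        refine Prod.ext (hι ?_) ?_
        · simp [hr]
        · simp
      map_add' := fun x y => by
        apply Subtype.ext
        refine Prod.ext (hι ?_) ?_
        · simp [hr]
        · simp }
  have hF : ∀ e, (F e : A × G) = (r e, π e) := fun e => rfl
  have hinj : Function.Injective F := by
    rw [injective_iff_map_eq_zero]
    intro e he
    have he2 : ((r e, π e) : A × G) = 0 := by rw [← hF, he]; rfl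
    have hr0 : r e = 0 := congrArg Prod.fst he2
    have hp0 : π e = 0 := congrArg Prod.snd he2
    have : e ∈ ι.range := by rw [hex]; exact hp0
    obtain ⟨a, rfl⟩ := this
    have h := hr (ι a)
    rw [hr0, ← map_nsmul] at h
    rw [hA a (hι h).symm, map_zero]
  have hsurj : Function.Surjective F := by
    rintro ⟨⟨a, g⟩, hx⟩
    have hx' : (QuotientAddGroup.mk a : A ⧸ (nsmulHom m A).range) = ψ g := hx
    obtain ⟨e, rfl⟩ := hπ g
    rw [hψ _ e rfl _ (hr e)] at hx'
    obtain ⟨b, hb⟩ := QuotientAddGroup.eq.1 hx'.symm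
    have hb' : m • b = -r e + a := hb
    refine ⟨e + ι b, ?_⟩
    apply Subtype.ext
    rw [hF]
    refine Prod.ext (hι ?_) ?_
    · simp only [hr]
      rw [nsmul_add, ← hr e, ← map_nsmul, hb', ← map_add]
      simp
    · simp [h0]
  refine ⟨AddEquiv.ofBijective F ⟨hinj, hsurj⟩, fun a => ?_, fun e => rfl⟩
  change (F (ι a) : A × G) = _
  rw [hF]
  refine Prod.ext (hι ?_) (h0 a)
  simp [hr]

/-- for `G` killed by `p^n` and `A` without `p^n`-torsion, the `p^n`-map
construction gives a bijection between equivalence classes of extensions of `G` by `A`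
and `Hom(G, A/p^nA)`: (i) every `f : G →+ A/p^nA` is the `p^n`-map of an extension
(namely `{(a, g) : a mod p^nA = f g}` with `A` included via `a ↦ (p^n • a, 0)`); and
(ii) two extensions with the same `p^n`-map are equivalent. -/
theorem snake_map_classifies_extensions.{u, v, w}
    {A : Type u} {G : Type v} [AddCommGroup A] [AddCommGroup G]
    (p : ℕ) (hp : p.Prime) (n : ℕ) (hn : 1 ≤ n)
    (hG : ∀ g : G, p ^ n • g = 0)
    (hA : ∀ a : A, p ^ n • a = 0 → a = 0) :
    -- (i) surjectivity: every homomorphism `f : G → A/p^nA` is a `p^n`-map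
    (∀ f : G →+ A ⧸ (nsmulHom (p ^ n) A).range,
      ∃ ι : A →+ standardExtension (p ^ n) f,
      ∃ π : standardExtension (p ^ n) f →+ G,
        (∀ a : A, ((ι a : A × G) : A × G) = (p ^ n • a, 0)) ∧
        (∀ x : standardExtension (p ^ n) f, π x = ((x : A × G) : A × G).2) ∧
        Function.Injective ι ∧ Function.Surjective π ∧ ι.range = π.ker ∧
        IsSnakeMap (p ^ n) ι π f) ∧
    -- (ii) injectivity: two extensions with the same `p^n`-map are equivalent
    (∀ (E₁ : Type w) (E₂ : Type w), ∀ (_ : AddCommGroup E₁) (_ : AddCommGroup E₂),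
      ∀ (ι₁ : A →+ E₁) (π₁ : E₁ →+ G),
        Function.Injective ι₁ → Function.Surjective π₁ → ι₁.range = π₁.ker →
      ∀ (ι₂ : A →+ E₂) (π₂ : E₂ →+ G),
        Function.Injective ι₂ → Function.Surjective π₂ → ι₂.range = π₂.ker →
      ∀ ψ : G →+ A ⧸ (nsmulHom (p ^ n) A).range,
        IsSnakeMap (p ^ n) ι₁ π₁ ψ → IsSnakeMap (p ^ n) ι₂ π₂ ψ →
      ∃ φ : E₁ ≃+ E₂, φ.toAddMonoidHom.comp ι₁ = ι₂ ∧ π₂.comp φ.toAddMonoidHom = π₁) := by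
  constructor
  · intro f
    generalize p ^ n = m at *
    refine ⟨{ toFun := fun a => ⟨(m • a, 0), ?_⟩, map_zero' := ?_, map_add' := ?_ },
      (AddMonoidHom.snd A G).comp (standardExtension m f).subtype,
      fun a => rfl, fun x => rfl, ?_, ?_, ?_, ?_⟩
    · change (QuotientAddGroup.mk (m • a) : A ⧸ (nsmulHom m A).range) = f 0
      rw [map_zero, QuotientAddGroup.eq_zero_iff]
      exact ⟨a, rfl⟩
    · apply Subtype.ext
      simp
    · intro x y
      apply Subtype.ext
      simp
    · rw [injective_iff_map_eq_zero]
      intro a ha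
      exact hA a (congrArg (fun x => (Subtype.val x).1) ha)
    · intro g
      obtain ⟨a, ha⟩ := QuotientAddGroup.mk_surjective (f g)
      exact ⟨⟨(a, g), ha⟩, rfl⟩
    · ext ⟨⟨a, g⟩, hx⟩
      constructor
      · rintro ⟨b, hb⟩
        exact (congrArg (fun x => (Subtype.val x).2) hb).symm
      · intro h
        have hg : g = 0 := h
        subst hg
        have hx' : (QuotientAddGroup.mk a : A ⧸ (nsmulHom m A).range) = f 0 := hx
        rw [map_zero, QuotientAddGroup.eq_zero_iff] at hx'
        obtain ⟨b, hb⟩ := hx'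
        exact ⟨b, Subtype.ext (Prod.ext hb rfl)⟩
    · rintro g ⟨⟨x, g'⟩, hx⟩ hg a ha
      have hg' : g' = g := hg
      subst hg'
      have h : m • a = m • x := congrArg (fun x => (Subtype.val x).1) ha
      have h2 : a = x := sub_eq_zero.1 (hA _ (by rw [nsmul_sub, h, sub_self]))
      subst h2
      exact Eq.symm hx
  · intro E₁ E₂ _ _ ι₁ π₁ i₁ s₁ e₁ ι₂ π₂ i₂ s₂ e₂ ψ h₁ h₂
    obtain ⟨Φ₁, a₁, b₁⟩ := snake_aux _ hG hA ι₁ π₁ i₁ s₁ e₁ ψ h₁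
    obtain ⟨Φ₂, a₂, b₂⟩ := snake_aux _ hG hA ι₂ π₂ i₂ s₂ e₂ ψ h₂
    refine ⟨Φ₁.trans Φ₂.symm, ?_, ?_⟩
    · ext a
      change Φ₂.symm (Φ₁ (ι₁ a)) = ι₂ a
      rw [AddEquiv.symm_apply_eq]
      exact Subtype.ext ((a₁ a).trans (a₂ a).symm)
    · ext e
      change π₂ (Φ₂.symm (Φ₁ e)) = π₁ e
      rw [← b₂, AddEquiv.apply_symm_apply, b₁]
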